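/- arXiv:2508.03992 — 4 statements merged into one kernel-verified Lean document; each statement's English description precedes it below -/
import Mathlib

section
/- Let m ≥ 1, let P, Q ∈ ℝ^{m×m} be orthogonal matrices, let δ₁,…,δ_m ≥ 0, and let h : ℝ → ℝ be a convex function satisfying h(-x) = h(x) for all x and which is nondecreasing on [0,∞). Then Σ_{i=1}^m h(Σ_{k=1}^m δ_k P_{ik} Q_{ik}) ≤ Σ_{k=1}^m h(δ_k). -/
open Matrix Finset

/-- The rows of a matrix `P` with `P * Pᵀ = 1` are unit vectors. -/
theorem sum_sq_row_eq_one {n : Type*} [Fintype n] [DecidableEq n] {P : Matrix n n ℝ}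
    (hP : P * Pᵀ = 1) (i : n) : ∑ k, P i k ^ 2 = 1 := by
  simpa [Matrix.mul_apply, sq] using congrFun (congrFun hP i) i

/-- The columns of a square matrix `P` with `P * Pᵀ = 1` are unit vectors. -/
theorem sum_sq_col_eq_one {n : Type*} [Fintype n] [DecidableEq n] {P : Matrix n n ℝ}
    (hP : P * Pᵀ = 1) (k : n) : ∑ i, P i k ^ 2 = 1 :=
  sum_sq_row_eq_one (P := Pᵀ) (by simpa using mul_eq_one_comm.mp hP) k

/-- An even function that is monotone on `[0, ∞)` is monotone in the absolute value. -/
theorem le_of_even_of_monotoneOn_of_abs_le {h : ℝ → ℝ} (heven : ∀ x, h (-x) = h x)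
    (hmono : MonotoneOn h (Set.Ici 0)) {x y : ℝ} (hxy : |x| ≤ y) : h x ≤ h y := by
  have habs : h |x| = h x := by
    rcases abs_choice x with hx | hx <;> simp [hx, heven]
  exact habs ▸ hmono (abs_nonneg x) ((abs_nonneg x).trans hxy) hxy

theorem abs_mul_le_half_add_sq (a b : ℝ) : |a * b| ≤ (a ^ 2 + b ^ 2) / 2 := by
  rw [abs_le]
  constructor <;> nlinarith [sq_nonneg (a + b), sq_nonneg (a - b)]

/-- Jensen's inequality summed over the rows of a doubly stochastic array of weights. -/
theorem ConvexOn.sum_map_sum_le {n : Type*} [Fintype n] {h : ℝ → ℝ}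
    (hconv : ConvexOn ℝ Set.univ h) {w : n → n → ℝ} (hw : ∀ i k, 0 ≤ w i k)
    (hrow : ∀ i, ∑ k, w i k = 1) (hcol : ∀ k, ∑ i, w i k = 1) (x : n → ℝ) :
    ∑ i, h (∑ k, w i k * x k) ≤ ∑ k, h (x k) :=
  calc ∑ i, h (∑ k, w i k * x k) ≤ ∑ i, ∑ k, w i k * h (x k) :=
        sum_le_sum fun i _ =>
          hconv.map_sum_le (fun k _ => hw i k) (hrow i) fun _ _ => Set.mem_univ _
    _ = ∑ k, h (x k) := by
        rw [sum_comm]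
        simp_rw [← sum_mul, hcol, one_mul]

theorem stmt_1 (m : ℕ) (hm : 1 ≤ m)
    (P Q : Matrix (Fin m) (Fin m) ℝ)
    (hP : P * Pᵀ = 1) (hQ : Q * Qᵀ = 1)
    (δ : Fin m → ℝ) (hδ : ∀ k, 0 ≤ δ k)
    (h : ℝ → ℝ) (hconv : ConvexOn ℝ Set.univ h)
    (heven : ∀ x, h (-x) = h x)
    (hmono : MonotoneOn h (Set.Ici 0)) :
    ∑ i, h (∑ k, δ k * P i k * Q i k) ≤ ∑ k, h (δ k) := by
  have hbound (i : Fin m) :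
      |∑ k, δ k * P i k * Q i k| ≤ ∑ k, (P i k ^ 2 + Q i k ^ 2) / 2 * δ k := by
    refine (abs_sum_le_sum_abs _ _).trans (sum_le_sum fun k _ => ?_)
    rw [mul_assoc, abs_mul, abs_of_nonneg (hδ k), mul_comm]
    exact mul_le_mul_of_nonneg_right (abs_mul_le_half_add_sq _ _) (hδ k)
  refine (sum_le_sum fun i _ =>
    le_of_even_of_monotoneOn_of_abs_le heven hmono (hbound i)).trans ?_
  refine hconv.sum_map_sum_le (w := fun i k => (P i k ^ 2 + Q i k ^ 2) / 2)
    (fun i k => by positivity) (fun i => ?_) (fun k => ?_) δ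
  · rw [← sum_div, sum_add_distrib, sum_sq_row_eq_one hP, sum_sq_row_eq_one hQ]
    norm_num
  · rw [← sum_div, sum_add_distrib, sum_sq_col_eq_one hP, sum_sq_col_eq_one hQ]
    norm_num
end

section
/- For every τ > 0 and every s ≥ 0, one has s/(2τ) − (e^τ/(τ(e^{2τ}−1))) · ((1 + (e^{2τ}−1) s)^{1/2} − 1) ≥ −1/4. -/
/-- A form of `tanh (τ / 2) ≤ τ / 2` for nonnegative `τ`. -/
lemma two_mul_exp_sub_one_le {τ : ℝ} (hτ : 0 ≤ τ) :
    2 * (Real.exp τ - 1) ≤ τ * (Real.exp τ + 1) := by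
  have h := Real.le_log_one_add_of_nonneg (sub_nonneg.2 (Real.one_le_exp hτ))
  rw [add_sub_cancel, Real.log_exp, div_le_iff₀ (by linarith [Real.exp_pos τ])] at h
  linarith

theorem stmt_3 (τ s : ℝ) (hτ : 0 < τ) (hs : 0 ≤ s) :
    -(1 / 4 : ℝ) ≤ s / (2 * τ) -
      (Real.exp τ / (τ * (Real.exp (2 * τ) - 1))) *
        (Real.sqrt (1 + (Real.exp (2 * τ) - 1) * s) - 1) := by
  have hE : 1 < Real.exp τ := Real.one_lt_exp_iff.2 hτ
  have htanh := two_mul_exp_sub_one_le hτ.le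
  have hexp : Real.exp (2 * τ) = Real.exp τ ^ 2 := by
    rw [sq, ← Real.exp_add, two_mul]
  rw [hexp]
  generalize Real.exp τ = E at *
  have hA : 0 < E ^ 2 - 1 := by nlinarith
  have hu : √(1 + (E ^ 2 - 1) * s) ^ 2 = 1 + (E ^ 2 - 1) * s :=
    Real.sq_sqrt (by positivity)
  generalize √(1 + (E ^ 2 - 1) * s) = u at *
  have hs' : s = (u ^ 2 - 1) / (E ^ 2 - 1) := by
    rw [eq_div_iff hA.ne']
    linarith
  have key : s / (2 * τ) - E / (τ * (E ^ 2 - 1)) * (u - 1) + 1 / 4 =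
      ((u - E) ^ 2 + (E - 1) * (τ * (E + 1) / 2 - (E - 1))) / (2 * τ * (E ^ 2 - 1)) := by
    rw [hs']
    field_simp
    ring
  have hnum : 0 ≤ (E - 1) * (τ * (E + 1) / 2 - (E - 1)) :=
    mul_nonneg (by linarith) (by linarith)
  have : 0 ≤ ((u - E) ^ 2 + (E - 1) * (τ * (E + 1) / 2 - (E - 1))) /
      (2 * τ * (E ^ 2 - 1)) := by
    positivity
  linarith
end

section
/- Fix τ > 0 and define g : ℝ → ℝ by g(λ) = (1/2)λ² − (e^τ/(e^{2τ}−1)) · ((1 + (e^{2τ}−1)λ²)^{1/2} − 1). Then g is differentiable with g'(λ) = λ (1 − e^τ (1 + (e^{2τ}−1)λ²)^{−1/2}), and for all a, b ∈ ℝ one has g(b) ≤ g(a) + g'(a)(b − a) + (1/2)(b − a)². -/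
noncomputable def gfun (τ : ℝ) (lam : ℝ) : ℝ :=
  (1 / 2) * lam ^ 2 -
    (Real.exp τ / (Real.exp (2 * τ) - 1)) *
      (Real.sqrt (1 + (Real.exp (2 * τ) - 1) * lam ^ 2) - 1)

noncomputable def gfun' (τ : ℝ) (lam : ℝ) : ℝ :=
  lam * (1 - Real.exp τ * (1 + (Real.exp (2 * τ) - 1) * lam ^ 2) ^ (-(1 / 2 : ℝ)))

theorem rpow_neg_half_eq_inv_sqrt {x : ℝ} (hx : 0 ≤ x) :
    x ^ (-(1 / 2 : ℝ)) = (Real.sqrt x)⁻¹ := by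
  rw [Real.rpow_neg hx, Real.sqrt_eq_rpow]

theorem one_add_mul_le_sqrt_mul_sqrt {c : ℝ} (hc : 0 ≤ c) (a b : ℝ) :
    1 + c * a * b ≤ Real.sqrt (1 + c * a ^ 2) * Real.sqrt (1 + c * b ^ 2) := by
  rw [← Real.sqrt_mul (by positivity)]
  apply Real.le_sqrt_of_sq_le
  nlinarith [mul_nonneg hc (sq_nonneg (a - b))]

/-- The tangent line inequality for the convex function `x ↦ √(1 + c * x ^ 2)`. -/
theorem sqrt_one_add_mul_sq_tangent_le {c : ℝ} (hc : 0 ≤ c) (a b : ℝ) :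
    Real.sqrt (1 + c * a ^ 2) + c * a * (Real.sqrt (1 + c * a ^ 2))⁻¹ * (b - a) ≤
      Real.sqrt (1 + c * b ^ 2) := by
  have hpos : 0 < Real.sqrt (1 + c * a ^ 2) := Real.sqrt_pos.2 (by positivity)
  have hsq : Real.sqrt (1 + c * a ^ 2) ^ 2 = 1 + c * a ^ 2 := Real.sq_sqrt (by positivity)
  have h : Real.sqrt (1 + c * a ^ 2) + c * a * (Real.sqrt (1 + c * a ^ 2))⁻¹ * (b - a) =
      (1 + c * a * b) / Real.sqrt (1 + c * a ^ 2) := by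
    field_simp
    linear_combination hsq
  rw [h, div_le_iff₀' hpos]
  exact one_add_mul_le_sqrt_mul_sqrt hc a b

theorem stmt_5 (τ : ℝ) (hτ : 0 < τ) :
    (∀ lam : ℝ, HasDerivAt (gfun τ) (gfun' τ lam) lam) ∧
    ∀ a b : ℝ, gfun τ b ≤ gfun τ a + gfun' τ a * (b - a) + (1 / 2) * (b - a) ^ 2 := by
  have hc : 0 < Real.exp (2 * τ) - 1 := sub_pos.2 (Real.one_lt_exp_iff.2 (by positivity))
  unfold gfun gfun'
  generalize Real.exp (2 * τ) - 1 = c at hc ⊢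
  have he : 0 < Real.exp τ := Real.exp_pos τ
  generalize Real.exp τ = e at he ⊢
  have hpos (x : ℝ) : 0 < 1 + c * x ^ 2 := by positivity
  constructor
  · intro x
    rw [rpow_neg_half_eq_inv_sqrt (hpos x).le]
    have hs : Real.sqrt (1 + c * x ^ 2) ≠ 0 := (Real.sqrt_pos.2 (hpos x)).ne'
    have hsq : HasDerivAt (fun y : ℝ => y ^ 2) (2 * x) x := by
      simpa using hasDerivAt_pow 2 x
    have hsqrt := ((hsq.const_mul c).const_add 1).sqrt (hpos x).ne'
    refine ((hsq.const_mul (1 / 2)).sub ((hsqrt.sub_const 1).const_mul (e / c))).congr_deriv ?_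
    field_simp
  · intro a b
    rw [rpow_neg_half_eq_inv_sqrt (hpos a).le]
    have h := mul_le_mul_of_nonneg_left (sqrt_one_add_mul_sq_tangent_le hc.le a b)
      (div_pos he hc).le
    have hec : e / c * c = e := div_mul_cancel₀ e hc.ne'
    linear_combination h - a * (Real.sqrt (1 + c * a ^ 2))⁻¹ * (b - a) * hec
end

section
/- Let m ≥ 1, τ > 0, and let V₁, V₂ ∈ ℝ^{m×m} satisfy ‖V₁‖_F ≤ √m and ‖V₂‖_F ≤ √m. Let U₁, U₂ : [0, τ] → ℝ^{m×m} be differentiable solutions of the matrix ODE ∂_t U = U − U Uᵀ U with U₁(0) = V₁, U₂(0) = V₂, and suppose ‖U₁(t)‖_F ≤ √m and ‖U₂(t)‖_F ≤ √m for all t ∈ [0, τ]. Then ‖U₁(t) − U₂(t)‖_F ≤ e^{(1+3m) t} ‖V₁ − V₂‖_F for all t ∈ [0, τ]. -/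
open Matrix

attribute [local instance] Matrix.frobeniusNormedAddCommGroup Matrix.frobeniusNormedSpace

/-- The Frobenius norm of a real matrix. -/
noncomputable def frobNorm {m : ℕ} (A : Matrix (Fin m) (Fin m) ℝ) : ℝ :=
  Real.sqrt (∑ i, ∑ j, (A i j) ^ 2)

theorem frobNorm_eq_norm {m : ℕ} (A : Matrix (Fin m) (Fin m) ℝ) : frobNorm A = ‖A‖ := by
  simp [frobNorm, frobenius_norm_def, Real.sqrt_eq_rpow]

theorem frobenius_norm_mul_transpose_mul_sub_le {n : Type*} [Fintype n]
    {A B : Matrix n n ℝ} {r : ℝ} (hA : ‖A‖ ≤ r) (hB : ‖B‖ ≤ r) :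
    ‖A * Aᵀ * A - B * Bᵀ * B‖ ≤ 3 * r ^ 2 * ‖A - B‖ := by
  have hr : 0 ≤ r := (norm_nonneg A).trans hA
  have mul_le {X Y Z : Matrix n n ℝ} {a b c : ℝ} (hX : ‖X‖ ≤ a) (hY : ‖Y‖ ≤ b) (hZ : ‖Z‖ ≤ c)
      (ha : 0 ≤ a) (hb : 0 ≤ b) : ‖X * Y * Z‖ ≤ a * b * c :=
    (frobenius_norm_mul _ _).trans <| mul_le_mul
      ((frobenius_norm_mul _ _).trans <| mul_le_mul hX hY (norm_nonneg _) ha) hZ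
      (norm_nonneg _) (mul_nonneg ha hb)
  have hAt : ‖Aᵀ‖ ≤ r := (frobenius_norm_transpose A).trans_le hA
  have hBt : ‖Bᵀ‖ ≤ r := (frobenius_norm_transpose B).trans_le hB
  have htr : ‖(A - B)ᵀ‖ ≤ ‖A - B‖ := (frobenius_norm_transpose _).le
  have hsplit : A * Aᵀ * A - B * Bᵀ * B
      = (A - B) * Aᵀ * A + B * (A - B)ᵀ * A + B * Bᵀ * (A - B) := by
    rw [transpose_sub]
    noncomm_ring
  rw [hsplit]
  calc _ ≤ ‖(A - B) * Aᵀ * A‖ + ‖B * (A - B)ᵀ * A‖ + ‖B * Bᵀ * (A - B)‖ := norm_add₃_le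
    _ ≤ ‖A - B‖ * r * r + r * ‖A - B‖ * r + r * r * ‖A - B‖ :=
      add_le_add (add_le_add (mul_le le_rfl hAt hA (norm_nonneg _) hr)
        (mul_le hB htr hA hr (norm_nonneg _))) (mul_le hB hBt le_rfl hr hr)
    _ = 3 * r ^ 2 * ‖A - B‖ := by ring

theorem stmt_11 (m : ℕ) (hm : 1 ≤ m) (τ : ℝ) (hτ : 0 < τ)
    (V₁ V₂ : Matrix (Fin m) (Fin m) ℝ)
    (hV₁ : frobNorm V₁ ≤ Real.sqrt m) (hV₂ : frobNorm V₂ ≤ Real.sqrt m)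
    (U₁ U₂ : ℝ → Matrix (Fin m) (Fin m) ℝ)
    (hU₁0 : U₁ 0 = V₁) (hU₂0 : U₂ 0 = V₂)
    (hU₁ode : ∀ t ∈ Set.Icc (0 : ℝ) τ,
      HasDerivWithinAt U₁ (U₁ t - U₁ t * (U₁ t)ᵀ * U₁ t) (Set.Icc (0 : ℝ) τ) t)
    (hU₂ode : ∀ t ∈ Set.Icc (0 : ℝ) τ,
      HasDerivWithinAt U₂ (U₂ t - U₂ t * (U₂ t)ᵀ * U₂ t) (Set.Icc (0 : ℝ) τ) t)
    (hU₁b : ∀ t ∈ Set.Icc (0 : ℝ) τ, frobNorm (U₁ t) ≤ Real.sqrt m)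
    (hU₂b : ∀ t ∈ Set.Icc (0 : ℝ) τ, frobNorm (U₂ t) ≤ Real.sqrt m) :
    ∀ t ∈ Set.Icc (0 : ℝ) τ,
      frobNorm (U₁ t - U₂ t) ≤ Real.exp ((1 + 3 * m) * t) * frobNorm (V₁ - V₂) := by
  simp only [frobNorm_eq_norm] at *
  subst hU₁0 hU₂0
  have hderiv (t : ℝ) (ht : t ∈ Set.Icc (0 : ℝ) τ) := (hU₁ode t ht).sub (hU₂ode t ht)
  intro t ht
  have key := norm_le_gronwallBound_of_norm_deriv_right_le (f := U₁ - U₂) (δ := ‖U₁ 0 - U₂ 0‖)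
    (K := 1 + 3 * m) (ε := 0) (fun s hs => (hderiv s hs).continuousWithinAt)
    (fun s hs => (hderiv s (Set.Ico_subset_Icc_self hs)).mono_of_mem_nhdsWithin
      (Icc_mem_nhdsGE_of_mem hs)) le_rfl (fun s hs => ?_) t ht
  · rw [gronwallBound_ε0, sub_zero, mul_comm] at key
    exact key
  · have hs' := Set.Ico_subset_Icc_self hs
    have hcubic := frobenius_norm_mul_transpose_mul_sub_le (hU₁b s hs') (hU₂b s hs')
    rw [Real.sq_sqrt m.cast_nonneg] at hcubic
    rw [sub_sub_sub_comm, add_zero, add_mul, one_mul]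
    exact (norm_sub_le _ _).trans (add_le_add le_rfl hcubic)
end
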